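/- For every finite set P ⊂ ℝ² of n ≥ 3 points in general position, there exists a threshold α₀ ∈ (0,π) such that for every α ∈ (α₀,π): the maximum number of edges of a plane α-bend graph on P equals M(P); the maximum number of edges of a plane α-arc graph on P equals M(P); the maximum number of edges of a plane α-bend multigraph on P equals 2·M(P); and the maximum number of edges of a plane α-arc multigraph on P equals 2·M(P). -/

import Mathlib

open EuclideanGeometry Real Set

noncomputable section

/-- The Euclidean plane. -/
abbrev Pt : Type := EuclideanSpace ℝ (Fin 2)

/-- The image of a one-bend edge `(a,b,c)`: the union of segments `[a,b]` and `[b,c]`. -/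
def bendImage (e : Pt × Pt × Pt) : Set Pt :=
  segment ℝ e.1 e.2.1 ∪ segment ℝ e.2.1 e.2.2

/-- The endpoints of a (bend or arc) edge `(a,b,c)` are `a` and `c`. -/
def edgeEndpoints (e : Pt × Pt × Pt) : Set Pt := {e.1, e.2.2}

/-- An `α`-bend edge: a triple `(a,b,c)` with `a ≠ c` and angle `α` at `b`. -/
def IsBendEdge (α : ℝ) (e : Pt × Pt × Pt) : Prop :=
  e.1 ≠ e.2.2 ∧ ∠ e.1 e.2.1 e.2.2 = α

/-- A plane `α`-bend multigraph on a finite vertex set `V`. -/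
def IsPlaneBendMultigraph (α : ℝ) (V : Finset Pt) (E : Finset (Pt × Pt × Pt)) : Prop :=
  (∀ e ∈ E, IsBendEdge α e ∧ e.1 ∈ V ∧ e.2.2 ∈ V) ∧
  (∀ e ∈ E, ∀ f ∈ E, e ≠ f → bendImage e ≠ bendImage f) ∧
  (∀ e ∈ E, ∀ v ∈ V, (v : Pt) ∈ bendImage e → (v : Pt) ∈ edgeEndpoints e) ∧
  (∀ e ∈ E, ∀ f ∈ E, e ≠ f →
    bendImage e ∩ bendImage f ⊆ edgeEndpoints e ∩ edgeEndpoints f)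

/-- A plane `α`-bend graph: a plane `α`-bend multigraph in which distinct edges
have distinct endpoint pairs. -/
def IsPlaneBendGraph (α : ℝ) (V : Finset Pt) (E : Finset (Pt × Pt × Pt)) : Prop :=
  IsPlaneBendMultigraph α V E ∧
  ∀ e ∈ E, ∀ f ∈ E, e ≠ f → edgeEndpoints e ≠ edgeEndpoints f

/-- An `α`-arc edge: a triple `(a,b,c)` with `a ≠ c`, `b` off of the line `ac`,
and angle `α` at `b`. -/
def IsArcEdge (α : ℝ) (e : Pt × Pt × Pt) : Prop :=
  e.1 ≠ e.2.2 ∧ e.2.1 ∉ affineSpan ℝ ({e.1, e.2.2} : Set Pt) ∧ ∠ e.1 e.2.1 e.2.2 = α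

/-- The image of an arc edge `(a,b,c)`: `{a,c}` together with the points strictly on the
same side of line `ac` as `b` from which the segment `ac` subtends the same angle as at `b`. -/
def arcImage (e : Pt × Pt × Pt) : Set Pt :=
  ({e.1, e.2.2} : Set Pt) ∪
    {x : Pt | (affineSpan ℝ ({e.1, e.2.2} : Set Pt)).SSameSide x e.2.1 ∧
      ∠ e.1 x e.2.2 = ∠ e.1 e.2.1 e.2.2}

/-- A plane `α`-arc multigraph on a finite vertex set `V`. -/
def IsPlaneArcMultigraph (α : ℝ) (V : Finset Pt) (E : Finset (Pt × Pt × Pt)) : Prop :=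
  (∀ e ∈ E, IsArcEdge α e ∧ e.1 ∈ V ∧ e.2.2 ∈ V) ∧
  (∀ e ∈ E, ∀ f ∈ E, e ≠ f → arcImage e ≠ arcImage f) ∧
  (∀ e ∈ E, ∀ v ∈ V, (v : Pt) ∈ arcImage e → (v : Pt) ∈ edgeEndpoints e) ∧
  (∀ e ∈ E, ∀ f ∈ E, e ≠ f →
    arcImage e ∩ arcImage f ⊆ edgeEndpoints e ∩ edgeEndpoints f)

/-- A plane `α`-arc graph: a plane `α`-arc multigraph in which distinct edges
have distinct endpoint pairs. -/
def IsPlaneArcGraph (α : ℝ) (V : Finset Pt) (E : Finset (Pt × Pt × Pt)) : Prop :=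
  IsPlaneArcMultigraph α V E ∧
  ∀ e ∈ E, ∀ f ∈ E, e ≠ f → edgeEndpoints e ≠ edgeEndpoints f

/-- A finite point set is in general position if no three of its points are collinear. -/
def GenPos (P : Finset Pt) : Prop :=
  ∀ p ∈ P, ∀ q ∈ P, ∀ r ∈ P, p ≠ q → p ≠ r → q ≠ r →
    ¬ Collinear ℝ ({p, q, r} : Set Pt)

/-- A planar straight-line graph on `P`: edges are (ordered representatives of unordered)
pairs of distinct points of `P` whose closed segments pairwise intersect only in shared
endpoints, and no segment contains a point of `P` other than its endpoints. -/
def IsPSLG (P : Finset Pt) (E : Finset (Pt × Pt)) : Prop :=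
  (∀ e ∈ E, e.1 ∈ P ∧ e.2 ∈ P ∧ e.1 ≠ e.2) ∧
  (∀ e ∈ E, ∀ f ∈ E, e ≠ f → segment ℝ e.1 e.2 ≠ segment ℝ f.1 f.2) ∧
  (∀ e ∈ E, ∀ p ∈ P, (p : Pt) ∈ segment ℝ e.1 e.2 → p = e.1 ∨ p = e.2) ∧
  (∀ e ∈ E, ∀ f ∈ E, e ≠ f →
    segment ℝ e.1 e.2 ∩ segment ℝ f.1 f.2 ⊆ ({e.1, e.2} : Set Pt) ∩ ({f.1, f.2} : Set Pt))

/-- `M P`: the maximum number of edges of a planar straight-line graph on `P`. -/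
def M (P : Finset Pt) : ℕ :=
  sSup {m : ℕ | ∃ E : Finset (Pt × Pt), IsPSLG P E ∧ E.card = m}

/-- Two segments (given by their endpoint pairs) cross: they meet in exactly one point,
which lies in the relative interior (open segment) of both. -/
def SegCross (s t : Pt × Pt) : Prop :=
  ∃ x : Pt, segment ℝ s.1 s.2 ∩ segment ℝ t.1 t.2 = {x} ∧
    x ∈ openSegment ℝ s.1 s.2 ∧ x ∈ openSegment ℝ t.1 t.2

/-! ### Coordinates -/

/-- Signed area (orientation) of the triangle `p q r`. -/
def orient (p q r : Pt) : ℝ := (q 0 - p 0) * (r 1 - p 1) - (q 1 - p 1) * (r 0 - p 0)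

/-- The inner product of `a - x` and `c - x`. -/
def dotAt (a c x : Pt) : ℝ := (a 0 - x 0) * (c 0 - x 0) + (a 1 - x 1) * (c 1 - x 1)

/-- Squared distance. -/
def sqd (a c : Pt) : ℝ := (a 0 - c 0) ^ 2 + (a 1 - c 1) ^ 2

/-- The thin lens around the segment `a c`. -/
def lens (κ : ℝ) (a c : Pt) : Set Pt := {x | dotAt a c x + κ * |orient a c x| ≤ 0}

lemma pt_ext {x y : Pt} (h0 : x 0 = y 0) (h1 : x 1 = y 1) : x = y := by
  ext i; fin_cases i
  · exact h0
  · exact h1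

lemma sqd_nonneg (a c : Pt) : 0 ≤ sqd a c := by unfold sqd; positivity

lemma sqd_pos {a c : Pt} (h : a ≠ c) : 0 < sqd a c := by
  rcases (sqd_nonneg a c).lt_or_eq with h1 | h1
  · exact h1
  · exfalso; apply h
    unfold sqd at h1
    apply pt_ext
    · nlinarith [sq_nonneg (a 0 - c 0), sq_nonneg (a 1 - c 1)]
    · nlinarith [sq_nonneg (a 0 - c 0), sq_nonneg (a 1 - c 1)]

lemma continuous_orient (p q : Pt) : Continuous (orient p q) := by
  unfold orient; fun_prop

lemma continuous_dotAt (p q : Pt) : Continuous (dotAt p q) := by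
  unfold dotAt; fun_prop

lemma orient_swap (a c x : Pt) : orient c a x = - orient a c x := by unfold orient; ring
lemma dotAt_swap (a c x : Pt) : dotAt c a x = dotAt a c x := by unfold dotAt; ring
lemma orient_self_left (a c : Pt) : orient a c a = 0 := by unfold orient; ring
lemma orient_self_right (a c : Pt) : orient a c c = 0 := by unfold orient; ring
lemma dotAt_self_left (a c : Pt) : dotAt a c a = 0 := by unfold dotAt; ring
lemma dotAt_self_right (a c : Pt) : dotAt a c c = 0 := by unfold dotAt; ring
lemma orient_rot (a b c : Pt) : orient b c a = orient a b c := by unfold orient; ring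

lemma lens_swap (κ : ℝ) (a c : Pt) : lens κ c a = lens κ a c := by
  ext x; simp only [lens, mem_ofPred_eq, orient_swap a c, dotAt_swap a c, abs_neg]

/-- Points on the line: parametrization. -/
lemma exists_param {a c x : Pt} (hac : a ≠ c) (h : orient a c x = 0) :
    ∃ t : ℝ, x 0 = a 0 + t * (c 0 - a 0) ∧ x 1 = a 1 + t * (c 1 - a 1) ∧
      dotAt a c x = t * (t - 1) * sqd a c := by
  have hs := sqd_pos hac
  have hs' := hs.ne'
  obtain ⟨t, ht⟩ : ∃ t, t * sqd a c = (x 0 - a 0) * (c 0 - a 0) + (x 1 - a 1) * (c 1 - a 1) :=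
    ⟨((x 0 - a 0) * (c 0 - a 0) + (x 1 - a 1) * (c 1 - a 1)) / sqd a c, by field_simp⟩
  have e0 : x 0 = a 0 + t * (c 0 - a 0) := by
    apply mul_left_cancel₀ hs'
    unfold sqd orient at *
    linear_combination (-(c 0 - a 0)) * ht - (c 1 - a 1) * h
  have e1 : x 1 = a 1 + t * (c 1 - a 1) := by
    apply mul_left_cancel₀ hs'
    unfold sqd orient at *
    linear_combination (-(c 1 - a 1)) * ht + (c 0 - a 0) * h
  refine ⟨t, e0, e1, ?_⟩
  unfold dotAt sqd
  rw [e0, e1]; ring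

lemma mem_segment_coord {a c x : Pt} : x ∈ segment ℝ a c ↔
    ∃ t : ℝ, 0 ≤ t ∧ t ≤ 1 ∧ x 0 = a 0 + t * (c 0 - a 0) ∧ x 1 = a 1 + t * (c 1 - a 1) := by
  constructor
  · rintro ⟨u, v, hu, hv, huv, rfl⟩
    refine ⟨v, hv, by linarith, ?_, ?_⟩
    · simp only [PiLp.add_apply, PiLp.smul_apply, smul_eq_mul]
      linear_combination a 0 * huv
    · simp only [PiLp.add_apply, PiLp.smul_apply, smul_eq_mul]
      linear_combination a 1 * huv
  · rintro ⟨t, h0, h1, e0, e1⟩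
    refine ⟨1 - t, t, by linarith, h0, by ring, ?_⟩
    apply pt_ext
    · simp only [PiLp.add_apply, PiLp.smul_apply, smul_eq_mul]; rw [e0]; ring
    · simp only [PiLp.add_apply, PiLp.smul_apply, smul_eq_mul]; rw [e1]; ring

lemma mem_segment_iff' {a c x : Pt} : x ∈ segment ℝ a c ↔ orient a c x = 0 ∧ dotAt a c x ≤ 0 := by
  constructor
  · rw [mem_segment_coord]
    rintro ⟨t, h0, h1, e0, e1⟩
    refine ⟨?_, ?_⟩
    · unfold orient; rw [e0, e1]; ring
    · have : dotAt a c x = - (t * (1 - t) * sqd a c) := by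
        unfold dotAt sqd; rw [e0, e1]; ring
      rw [this]
      have := mul_nonneg (mul_nonneg h0 (sub_nonneg.2 h1)) (sqd_nonneg a c)
      linarith
  · rintro ⟨h, hd⟩
    by_cases hac : a = c
    · subst hac
      have : dotAt a a x = sqd a x := by unfold dotAt sqd; ring
      rw [this] at hd
      by_cases hx : a = x
      · subst hx; exact left_mem_segment ..
      · exact absurd (sqd_pos hx) (not_lt.2 hd)
    · obtain ⟨t, e0, e1, e2⟩ := exists_param hac h
      rw [mem_segment_coord]
      have hs := sqd_pos hac
      rw [e2] at hd
      have ht : t * (t - 1) ≤ 0 := by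
        by_contra hh; push Not at hh
        exact absurd (mul_pos hh hs) (not_lt.2 hd)
      exact ⟨t, by nlinarith, by nlinarith, e0, e1⟩

lemma eq_of_orient_dot {a c x : Pt} (hac : a ≠ c) (h : orient a c x = 0) (hd : dotAt a c x = 0) :
    x = a ∨ x = c := by
  obtain ⟨t, e0, e1, e2⟩ := exists_param hac h
  rw [hd] at e2
  have hs := (sqd_pos hac).ne'
  have : t = 0 ∨ t = 1 := by
    have := (mul_eq_zero.1 e2.symm).resolve_right hs
    rcases mul_eq_zero.1 this with h | h
    · exact Or.inl h
    · exact Or.inr (by linarith)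
  rcases this with rfl | rfl
  · left; apply pt_ext <;> simp [e0, e1]
  · right; apply pt_ext <;> simp [e0, e1]

lemma collinear_iff_orient {a b c : Pt} (hab : a ≠ b) :
    Collinear ℝ ({a, b, c} : Set Pt) ↔ orient a b c = 0 := by
  rw [collinear_iff_of_mem (p₀ := a) (by simp)]
  constructor
  · rintro ⟨v, hv⟩
    obtain ⟨r, hr⟩ := hv b (by simp)
    obtain ⟨s, hs⟩ := hv c (by simp)
    unfold orient
    rw [hr, hs]
    simp
    ring
  · intro h
    obtain ⟨t, e0, e1, -⟩ := exists_param hab h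
    refine ⟨b - a, ?_⟩
    rintro p (rfl | rfl | rfl)
    · exact ⟨0, by simp⟩
    · exact ⟨1, by simp⟩
    · refine ⟨t, pt_ext ?_ ?_⟩
      · simp [e0]; ring
      · simp [e1]; ring

lemma mem_affineSpan_iff_orient {a c x : Pt} (hac : a ≠ c) :
    x ∈ affineSpan ℝ ({a, c} : Set Pt) ↔ orient a c x = 0 := by
  rw [← collinear_iff_orient hac]
  constructor
  · intro h
    have := collinear_insert_of_mem_affineSpan_pair h
    convert this using 1
    ext y; simp; tauto
  · intro h
    exact h.mem_affineSpan_of_mem_of_ne (by simp) (by simp) (by simp) hac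

lemma sSameSide_iff_orient {a c x y : Pt} (hac : a ≠ c) :
    (affineSpan ℝ ({a, c} : Set Pt)).SSameSide x y ↔ 0 < orient a c x * orient a c y := by
  rw [AffineSubspace.sSameSide_iff_exists_left (left_mem_affineSpan_pair ℝ a c),
    mem_affineSpan_iff_orient hac, mem_affineSpan_iff_orient hac]
  constructor
  · rintro ⟨hx, hy, p, hp, hr⟩
    rw [mem_affineSpan_iff_orient hac] at hp
    rcases hr with h | h | ⟨r, s, hr, hs, h⟩
    · exfalso; apply hx
      have : x = a := by simpa [sub_eq_zero] using h
      rw [this, orient_self_left]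
    · exfalso; apply hy
      have : y = p := by simpa [sub_eq_zero] using h
      rw [this, hp]
    · have h0 := congrArg (fun v : Pt => v 0) h
      have h1 := congrArg (fun v : Pt => v 1) h
      simp at h0 h1
      have e : r * orient a c x = s * orient a c y := by
        have : s * orient a c y = s * (orient a c y - orient a c p) := by rw [hp]; ring
        rw [this]
        unfold orient
        linear_combination (c 0 - a 0) * h1 - (c 1 - a 1) * h0
      have e2 : s * (orient a c x * orient a c y) = r * (orient a c x)^2 := by
        linear_combination (- orient a c x) * e
      have : 0 < r * (orient a c x)^2 := by positivity
      rw [← e2] at this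
      exact (pos_iff_pos_of_mul_pos this).1 hs
  · intro h
    have hx : orient a c x ≠ 0 := by rintro h0; simp [h0] at h
    have hy : orient a c y ≠ 0 := by rintro h0; simp [h0] at h
    refine ⟨hx, hy, y - (orient a c y / orient a c x) • (x - a), ?_, ?_⟩
    · rw [mem_affineSpan_iff_orient hac]
      have : orient a c (y - (orient a c y / orient a c x) • (x - a)) =
          orient a c y - orient a c y / orient a c x * orient a c x := by
        generalize orient a c y / orient a c x = t
        unfold orient; simp; ring
      rw [this]; field_simp; ring
    · have ht : 0 < orient a c y / orient a c x := by
        have : orient a c y / orient a c x = (orient a c x * orient a c y) / (orient a c x)^2 := by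
          field_simp
        rw [this]; positivity
      have : y -ᵥ (y - (orient a c y / orient a c x) • (x - a)) =
        (orient a c y / orient a c x) • (x -ᵥ a) := by simp
      rw [this]
      exact SameRay.sameRay_nonneg_smul_right _ ht.le

lemma inner_eq_dotAt (a c x : Pt) : inner ℝ (a -ᵥ x) (c -ᵥ x) = dotAt a c x := by
  simp [PiLp.inner_apply, Fin.sum_univ_two, dotAt]; ring

lemma norm_sq_eq (a x : Pt) : ‖a -ᵥ x‖ ^ 2 = sqd a x := by
  rw [EuclideanSpace.norm_sq_eq]; simp [Fin.sum_univ_two, sqd]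

lemma dot_orient_sq (a c x : Pt) : dotAt a c x ^ 2 + orient a c x ^ 2 = sqd a x * sqd c x := by
  unfold dotAt orient sqd; ring

/-- The angle condition in coordinates. -/
lemma angle_iff {α : ℝ} (h1 : π / 2 < α) (h2 : α < π) (a b c : Pt) :
    ∠ a b c = α ↔ orient a c b ≠ 0 ∧
      dotAt a c b + (-(cos α / sin α)) * |orient a c b| = 0 := by
  have hs : 0 < sin α := sin_pos_of_pos_of_lt_pi (by linarith [pi_pos]) h2
  have hc : cos α < 0 := cos_neg_of_pi_div_two_lt_of_lt h1 (by linarith [pi_pos])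
  have hn : (‖a -ᵥ b‖ * ‖c -ᵥ b‖) ^ 2 = dotAt a c b ^ 2 + orient a c b ^ 2 := by
    rw [mul_pow, norm_sq_eq, norm_sq_eq, dot_orient_sq]
  have hcs := sin_sq_add_cos_sq α
  have hinner := InnerProductGeometry.cos_angle_mul_norm_mul_norm (a -ᵥ b) (c -ᵥ b)
  rw [inner_eq_dotAt] at hinner
  set n := ‖a -ᵥ b‖ * ‖c -ᵥ b‖ with hnn
  have hn0 : 0 ≤ n := by positivity
  constructor
  · intro h
    unfold EuclideanGeometry.angle at h
    rw [h] at hinner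
    have hnpos : 0 < n := by
      rcases hn0.lt_or_eq with h' | h'
      · exact h'
      · exfalso
        rcases mul_eq_zero.1 h'.symm with h0 | h0
        · rw [norm_eq_zero] at h0
          rw [h0, InnerProductGeometry.angle_zero_left] at h; linarith
        · rw [norm_eq_zero] at h0
          rw [h0, InnerProductGeometry.angle_zero_right] at h; linarith
    have ho : |orient a c b| = sin α * n := by
      have : orient a c b ^ 2 = (sin α * n) ^ 2 := by
        rw [← hinner] at hn
        linear_combination - hn - n ^ 2 * hcs
      rw [← abs_of_nonneg (mul_nonneg hs.le hn0)]
      exact (sq_eq_sq_iff_abs_eq_abs _ _).1 this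
    refine ⟨?_, ?_⟩
    · rw [← abs_pos, ho]; positivity
    · rw [ho, ← hinner]; field_simp; ring
  · rintro ⟨ho, he⟩
    have hop : 0 < |orient a c b| := abs_pos.2 ho
    have hd : sin α * dotAt a c b = cos α * |orient a c b| := by
      field_simp at he; linarith
    have hn2 : (sin α * n) ^ 2 = |orient a c b| ^ 2 := by
      rw [sq_abs]
      have := congrArg (fun z => z ^ 2) hd
      simp only [mul_pow, sq_abs] at this
      linear_combination (sin α)^2 * hn + this + orient a c b ^ 2 * hcs
    have hn3 : sin α * n = |orient a c b| := by
      rwa [sq_eq_sq₀ (mul_nonneg hs.le hn0) (abs_nonneg _)] at hn2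
    have hnpos : 0 < n := by
      rcases hn0.lt_or_eq with h' | h'
      · exact h'
      · rw [← h'] at hn3; simp at hn3; exact absurd hn3.symm hop.ne'
    unfold EuclideanGeometry.angle InnerProductGeometry.angle
    rw [inner_eq_dotAt, ← hnn]
    have : dotAt a c b / n = cos α := by
      rw [div_eq_iff hnpos.ne']
      apply mul_left_cancel₀ hs.ne'
      rw [hd, ← hn3]; ring
    rw [this, arccos_cos (by linarith [pi_pos]) h2.le]

/-! ### Lenses shrink to segments -/

lemma left_mem_lens (κ : ℝ) (a c : Pt) : a ∈ lens κ a c := by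
  show dotAt a c a + κ * |orient a c a| ≤ 0
  simp [orient_self_left, dotAt_self_left]

lemma isCompact_disk (a c : Pt) : IsCompact {x : Pt | dotAt a c x ≤ 0} := by
  apply Metric.isCompact_of_isClosed_isBounded
  · exact isClosed_le (continuous_dotAt a c) continuous_const
  · rw [isBounded_iff_forall_norm_le]
    refine ⟨‖a‖ + ‖a - c‖, fun x hx => ?_⟩
    have hx : dotAt a c x ≤ 0 := hx
    have : ‖x - a‖ ≤ ‖a - c‖ := by
      have h1 : ‖x - a‖ ^ 2 = sqd x a := norm_sq_eq x a
      have h2 : ‖a - c‖ ^ 2 = sqd a c := norm_sq_eq a c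
      have : ‖x - a‖ ^ 2 ≤ ‖a - c‖ ^ 2 := by
        rw [h1, h2]
        unfold sqd
        unfold dotAt at hx
        nlinarith [sq_nonneg (c 0 - x 0), sq_nonneg (c 1 - x 1)]
      exact (sq_le_sq₀ (norm_nonneg _) (norm_nonneg _)).1 this
    calc ‖x‖ = ‖a + (x - a)‖ := by congr 1; abel
      _ ≤ ‖a‖ + ‖x - a‖ := norm_add_le _ _
      _ ≤ _ := by linarith

lemma dotAt_ge (a c x : Pt) : - sqd a c ≤ dotAt a c x := by
  unfold sqd dotAt
  nlinarith [sq_nonneg (a 0 - x 0 + (c 0 - x 0)), sq_nonneg (a 1 - x 1 + (c 1 - x 1)),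
    sq_nonneg (a 0 - c 0), sq_nonneg (a 1 - c 1)]

lemma eventually_lens_disjoint {F : Set Pt} (hF : IsClosed F) (a c p r : Pt)
    (h : ∀ x ∈ F, x ∈ segment ℝ a c → x ∈ segment ℝ p r → False) :
    ∀ᶠ κ : ℝ in Filter.atTop, ∀ x ∈ F, x ∈ lens κ a c → x ∈ lens κ p r → False := by
  set K : Set Pt := {x : Pt | dotAt a c x ≤ 0} ∩ (F ∩ {x : Pt | dotAt p r x ≤ 0}) with hK
  have hKc : IsCompact K := (isCompact_disk a c).inter_right
    (hF.inter (isCompact_disk p r).isClosed)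
  have key : ∃ ε > 0, ∀ x ∈ K, ε ≤ |orient a c x| + |orient p r x| := by
    rcases K.eq_empty_or_nonempty with hE | hN
    · exact ⟨1, one_pos, by simp [hE]⟩
    · have hcont : Continuous (fun x => |orient a c x| + |orient p r x|) :=
        (continuous_orient a c).abs.add (continuous_orient p r).abs
      obtain ⟨x0, hx0, hmin⟩ := hKc.exists_isMinOn hN hcont.continuousOn
      refine ⟨_, ?_, fun x hx => hmin hx⟩
      by_contra hneg
      have h1 := abs_nonneg (orient a c x0)
      have h2 := abs_nonneg (orient p r x0)
      simp only [gt_iff_lt, not_lt] at hneg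
      have e1 : orient a c x0 = 0 := abs_eq_zero.1 (by linarith)
      have e2 : orient p r x0 = 0 := abs_eq_zero.1 (by linarith)
      exact h x0 hx0.2.1 (mem_segment_iff'.2 ⟨e1, hx0.1⟩) (mem_segment_iff'.2 ⟨e2, hx0.2.2⟩)
  obtain ⟨ε, hε, hmin⟩ := key
  filter_upwards [Filter.eventually_gt_atTop ((sqd a c + sqd p r) / ε),
    Filter.eventually_ge_atTop 0] with κ hκ hκ0 x hxF h1 h2
  have h1 : dotAt a c x + κ * |orient a c x| ≤ 0 := h1
  have h2 : dotAt p r x + κ * |orient p r x| ≤ 0 := h2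
  have g1 := mul_nonneg hκ0 (abs_nonneg (orient a c x))
  have g2 := mul_nonneg hκ0 (abs_nonneg (orient p r x))
  have := hmin x ⟨show dotAt a c x ≤ 0 by linarith, hxF, show dotAt p r x ≤ 0 by linarith⟩
  rw [div_lt_iff₀ hε] at hκ
  have := mul_le_mul_of_nonneg_left this hκ0
  linarith [dotAt_ge a c x, dotAt_ge p r x]

lemma eventually_lens_fan {a c d : Pt} (h : orient a c d ≠ 0) :
    ∀ᶠ κ : ℝ in Filter.atTop, ∀ x, x ∈ lens κ a c → x ∈ lens κ a d → x = a := by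
  have hp : 0 < |orient a c d| := abs_pos.2 h
  filter_upwards [Filter.eventually_gt_atTop ((sqd a c + sqd a d) / |orient a c d|),
    Filter.eventually_ge_atTop 0] with κ hκ hκ0 x h1 h2
  by_contra hxa
  have hs := sqd_pos hxa
  rw [div_lt_iff₀ hp] at hκ
  have h1 : dotAt a c x + κ * |orient a c x| ≤ 0 := h1
  have h2 : dotAt a d x + κ * |orient a d x| ≤ 0 := h2
  set A := (x 0 - a 0) * (c 0 - a 0) + (x 1 - a 1) * (c 1 - a 1) with hA
  set B := (x 0 - a 0) * (d 0 - a 0) + (x 1 - a 1) * (d 1 - a 1) with hB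
  have eA : dotAt a c x = sqd x a - A := by unfold dotAt sqd; rw [hA]; ring
  have eB : dotAt a d x = sqd x a - B := by unfold dotAt sqd; rw [hB]; ring
  have g1 : κ * |orient a c x| ≤ A := by linarith
  have g2 : κ * |orient a d x| ≤ B := by linarith
  have A0 : 0 ≤ A := le_trans (mul_nonneg hκ0 (abs_nonneg _)) g1
  have B0 : 0 ≤ B := le_trans (mul_nonneg hκ0 (abs_nonneg _)) g2
  have id1 : orient a c d * sqd x a = orient a c x * B - orient a d x * A := by
    rw [hA, hB]; unfold orient sqd; ring
  have id2 : |orient a c d| * sqd x a ≤ |orient a c x| * B + |orient a d x| * A := by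
    calc |orient a c d| * sqd x a = |orient a c d * sqd x a| := by
          rw [abs_mul, abs_of_pos hs]
      _ = |orient a c x * B - orient a d x * A| := by rw [id1]
      _ ≤ |orient a c x * B| + |orient a d x * A| := abs_sub _ _
      _ = _ := by rw [abs_mul, abs_mul, abs_of_nonneg A0, abs_of_nonneg B0]
  have id3 : κ * |orient a c d| * sqd x a ≤ 2 * (A * B) := by
    have := mul_le_mul_of_nonneg_left id2 hκ0
    have u1 := mul_le_mul_of_nonneg_right g1 B0
    have u2 := mul_le_mul_of_nonneg_right g2 A0
    linarith
  have id4 : 2 * (A * B) ≤ (sqd a c + sqd a d) * sqd x a := by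
    have cA : A ^ 2 ≤ sqd x a * sqd a c := by
      have : A ^ 2 + orient a c x ^ 2 = sqd x a * sqd a c := by
        rw [hA]; unfold orient sqd; ring
      linarith [sq_nonneg (orient a c x)]
    have cB : B ^ 2 ≤ sqd x a * sqd a d := by
      have : B ^ 2 + orient a d x ^ 2 = sqd x a * sqd a d := by
        rw [hB]; unfold orient sqd; ring
      linarith [sq_nonneg (orient a d x)]
    have hAB : 0 ≤ A ^ 2 + B ^ 2 - 2 * (A * B) := by
      have := sq_nonneg (A - B)
      linarith [this, show (A - B) ^ 2 = A ^ 2 + B ^ 2 - 2 * (A * B) by ring]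
    have : (sqd a c + sqd a d) * sqd x a = sqd x a * sqd a c + sqd x a * sqd a d := by ring
    linarith
  have := mul_lt_mul_of_pos_right hκ hs
  linarith

/-! ### Abstract curves -/

/-- A curve from `a` to `c`, on the left of the oriented line `a c`, inside the lens. -/
structure Crv (κ : ℝ) (a c : Pt) (S : Set Pt) : Prop where
  left_mem : a ∈ S
  right_mem : c ∈ S
  sub_lens : S ⊆ lens κ a c
  nonneg : ∀ x ∈ S, 0 ≤ orient a c x
  ends : ∀ x ∈ S, orient a c x = 0 → x = a ∨ x = c
  conn : IsPreconnected S
  sep : ∃ G : Pt → ℝ, Continuous G ∧ (∀ x, 0 < orient a c x → G x = 0 → x ∈ S) ∧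
    (∀ x, orient a c x = 0 → dotAt a c x < 0 → G x < 0) ∧
    (∀ x, 0 < orient a c x → G x ≤ 0 → x ∈ lens κ a c)

lemma Crv.cross {κ : ℝ} {a c p r : Pt} {S T : Set Pt} (hS : Crv κ a c S)
    (hT : IsPreconnected T) (hp : p ∈ T) (hr : r ∈ T)
    (hop : orient a c p < 0) (hor : 0 < orient a c r) (hrl : r ∉ lens κ a c)
    (hTF : ∀ x ∈ T, orient a c x = 0 → 0 ≤ dotAt a c x → False) :
    ∃ x ∈ S, x ∈ T ∧ 0 < orient a c x := by
  obtain ⟨G, hG, g1, g2, g3⟩ := hS.sep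
  by_contra hcon
  push Not at hcon
  have hO := continuous_orient a c
  have hU : IsOpen ({x | 0 < orient a c x} ∩ {x | 0 < G x}) :=
    (isOpen_lt continuous_const hO).inter (isOpen_lt continuous_const hG)
  have hW : IsOpen ({x | orient a c x < 0} ∪ {x | G x < 0}) :=
    (isOpen_lt hO continuous_const).union (isOpen_lt hG continuous_const)
  have cov : T ⊆ ({x | 0 < orient a c x} ∩ {x | 0 < G x}) ∪
      ({x | orient a c x < 0} ∪ {x | G x < 0}) := by
    intro x hx
    rcases lt_trichotomy (orient a c x) 0 with h | h | h
    · exact Or.inr (Or.inl h)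
    · refine Or.inr (Or.inr (g2 x h ?_))
      by_contra hd
      exact hTF x hx h (not_lt.1 hd)
    · rcases lt_trichotomy (G x) 0 with h' | h' | h'
      · exact Or.inr (Or.inr h')
      · exact absurd h (not_lt.2 (hcon x (g1 x h h') hx))
      · exact Or.inl ⟨h, h'⟩
  obtain ⟨x, hxT, hxU, hxW⟩ := hT _ _ hU hW cov
    ⟨r, hr, hor, by
      show 0 < G r
      by_contra hneg
      exact hrl (g3 r hor (not_lt.1 hneg))⟩ ⟨p, hp, Or.inl hop⟩
  have hx1 : 0 < orient a c x := hxU.1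
  have hx2 : 0 < G x := hxU.2
  rcases hxW with h | h
  · exact lt_asymm hx1 h
  · exact lt_asymm hx2 h

/-! ### Bends as curves -/

lemma bary {a b c : Pt} (hT : orient a c b ≠ 0) (x : Pt) :
    ∃ u v w : ℝ, u * orient a c b = orient c b x ∧ v * orient a c b = orient b a x ∧
      w * orient a c b = orient a c x ∧ u + v + w = 1 ∧
      x 0 = u * a 0 + v * c 0 + w * b 0 ∧ x 1 = u * a 1 + v * c 1 + w * b 1 := by
  refine ⟨orient c b x / orient a c b, orient b a x / orient a c b, orient a c x / orient a c b,
    by field_simp, by field_simp, by field_simp, ?_, ?_, ?_⟩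
  · field_simp; unfold orient; ring
  · field_simp; unfold orient; ring
  · field_simp; unfold orient; ring

lemma g_bary {κ : ℝ} {a b c x : Pt} {u v w : ℝ} (h : u + v + w = 1)
    (e0 : x 0 = u * a 0 + v * c 0 + w * b 0) (e1 : x 1 = u * a 1 + v * c 1 + w * b 1)
    (hb : dotAt a c b + κ * orient a c b = 0) :
    dotAt a c x + κ * orient a c x =
      -(u * v * sqd a c + u * w * sqd a b + v * w * sqd c b) := by
  have hu : u = 1 - v - w := by linarith
  subst hu
  have : dotAt a c x + κ * orient a c x = w * (dotAt a c b + κ * orient a c b)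
      -((1 - v - w) * v * sqd a c + (1 - v - w) * w * sqd a b + v * w * sqd c b) := by
    unfold dotAt orient sqd; rw [e0, e1]; ring
  rw [this, hb]; ring

/-- Barycentric description of a triangle's two upper sides. -/
lemma mem_bend_of {a b c x : Pt} (hT : 0 < orient a c b) (hx : 0 ≤ orient a c x)
    (h1 : 0 ≤ orient c b x) (h2 : 0 ≤ orient b a x) (h : orient c b x = 0 ∨ orient b a x = 0) :
    x ∈ segment ℝ a b ∪ segment ℝ b c := by
  obtain ⟨u, v, w, hu, hv, hw, hs, e0, e1⟩ := bary hT.ne' x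
  have u0 : 0 ≤ u := nonneg_of_mul_nonneg_left (hu ▸ h1) hT
  have v0 : 0 ≤ v := nonneg_of_mul_nonneg_left (hv ▸ h2) hT
  have w0 : 0 ≤ w := nonneg_of_mul_nonneg_left (hw ▸ hx) hT
  rcases h with h | h
  · rw [h] at hu
    have : u = 0 := (mul_eq_zero.1 hu).resolve_right hT.ne'
    subst this
    right
    rw [mem_segment_coord]
    refine ⟨v, v0, by linarith, ?_, ?_⟩
    · rw [e0]; linear_combination b 0 * hs
    · rw [e1]; linear_combination b 1 * hs
  · rw [h] at hv
    have : v = 0 := (mul_eq_zero.1 hv).resolve_right hT.ne'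
    subst this
    left
    rw [mem_segment_coord]
    refine ⟨w, w0, by linarith, ?_, ?_⟩
    · rw [e0]; linear_combination a 0 * hs
    · rw [e1]; linear_combination a 1 * hs

lemma triangle_lens {κ : ℝ} {a b c x : Pt} (hT : 0 < orient a c b)
    (hb : dotAt a c b + κ * orient a c b = 0) (hx : 0 ≤ orient a c x)
    (h1 : 0 ≤ orient c b x) (h2 : 0 ≤ orient b a x) : x ∈ lens κ a c := by
  obtain ⟨u, v, w, hu, hv, hw, hs, e0, e1⟩ := bary hT.ne' x
  have u0 : 0 ≤ u := nonneg_of_mul_nonneg_left (hu ▸ h1) hT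
  have v0 : 0 ≤ v := nonneg_of_mul_nonneg_left (hv ▸ h2) hT
  have w0 : 0 ≤ w := nonneg_of_mul_nonneg_left (hw ▸ hx) hT
  show dotAt a c x + κ * |orient a c x| ≤ 0
  rw [abs_of_nonneg hx, g_bary hs e0 e1 hb]
  have := sqd_nonneg a c
  have := sqd_nonneg a b
  have := sqd_nonneg c b
  have : 0 ≤ u * v * sqd a c + u * w * sqd a b + v * w * sqd c b := by positivity
  linarith

lemma bend_coords {a b c x : Pt} (hT : 0 < orient a c b) (hx : x ∈ segment ℝ a b ∪ segment ℝ b c) :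
    0 ≤ orient a c x ∧ 0 ≤ orient c b x ∧ 0 ≤ orient b a x ∧
      (orient a c x = 0 → x = a ∨ x = c) := by
  rcases hx with hx | hx
  · obtain ⟨t, t0, t1, e0, e1⟩ := mem_segment_coord.1 hx
    have i1 : orient a c x = t * orient a c b := by unfold orient; rw [e0, e1]; ring
    have i2 : orient c b x = (1 - t) * orient a c b := by unfold orient; rw [e0, e1]; ring
    have i3 : orient b a x = 0 := by unfold orient; rw [e0, e1]; ring
    refine ⟨by rw [i1]; positivity, by rw [i2]; exact mul_nonneg (by linarith) hT.le, i3.ge, ?_⟩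
    intro h
    rw [i1] at h
    have : t = 0 := (mul_eq_zero.1 h).resolve_right hT.ne'
    left; apply pt_ext <;> simp [e0, e1, this]
  · obtain ⟨t, t0, t1, e0, e1⟩ := mem_segment_coord.1 hx
    have i1 : orient a c x = (1 - t) * orient a c b := by unfold orient; rw [e0, e1]; ring
    have i2 : orient c b x = 0 := by unfold orient; rw [e0, e1]; ring
    have i3 : orient b a x = t * orient a c b := by unfold orient; rw [e0, e1]; ring
    refine ⟨by rw [i1]; exact mul_nonneg (by linarith) hT.le, i2.ge, by rw [i3]; positivity, ?_⟩
    intro h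
    rw [i1] at h
    have h1 := (mul_eq_zero.1 h).resolve_right hT.ne'
    have : t = 1 := by linarith
    right; apply pt_ext <;> simp [e0, e1, this]

lemma ne_of_orient {a b c : Pt} (h : orient a c b ≠ 0) : a ≠ c := by
  rintro rfl; apply h; unfold orient; ring

lemma bend_crv {κ : ℝ} {a b c : Pt} (hT : 0 < orient a c b)
    (hb : dotAt a c b + κ * orient a c b = 0) :
    Crv κ a c (segment ℝ a b ∪ segment ℝ b c) where
  left_mem := Or.inl (left_mem_segment ..)
  right_mem := Or.inr (right_mem_segment ..)
  sub_lens := fun x hx => by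
    obtain ⟨h1, h2, h3, -⟩ := bend_coords hT hx
    exact triangle_lens hT hb h1 h2 h3
  nonneg := fun x hx => (bend_coords hT hx).1
  ends := fun x hx => (bend_coords hT hx).2.2.2
  conn := IsPreconnected.union b (right_mem_segment ..) (left_mem_segment ..)
    (convex_segment _ _).isPreconnected (convex_segment _ _).isPreconnected
  sep := by
    refine ⟨fun x => - min (orient c b x) (orient b a x),
      ((continuous_orient c b).min (continuous_orient b a)).neg, ?_, ?_, ?_⟩
    · intro x hx h
      have h : min (orient c b x) (orient b a x) = 0 := by simpa using h
      have h1 := min_le_left (orient c b x) (orient b a x)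
      have h2 := min_le_right (orient c b x) (orient b a x)
      rw [h] at h1 h2
      refine mem_bend_of hT hx.le h1 h2 ?_
      rcases min_choice (orient c b x) (orient b a x) with h' | h'
      · left; rw [← h', h]
      · right; rw [← h', h]
    · intro x hx hd
      have hac := ne_of_orient hT.ne'
      obtain ⟨t, e0, e1, e2⟩ := exists_param hac hx
      have hs := sqd_pos hac
      rw [e2] at hd
      have ht : t * (t - 1) < 0 := by
        by_contra hh
        exact absurd (mul_nonneg (not_lt.1 hh) hs.le) (not_le.2 hd)
      have t0 : 0 < t := by nlinarith
      have t1 : 0 < 1 - t := by nlinarith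
      have i2 : orient c b x = (1 - t) * orient a c b := by unfold orient; rw [e0, e1]; ring
      have i3 : orient b a x = t * orient a c b := by unfold orient; rw [e0, e1]; ring
      show - min (orient c b x) (orient b a x) < 0
      rw [neg_lt_zero, lt_min_iff, i2, i3]
      exact ⟨by positivity, by positivity⟩
    · intro x hx h
      have h : 0 ≤ min (orient c b x) (orient b a x) := by simpa using h
      rw [le_min_iff] at h
      exact triangle_lens hT hb hx.le h.1 h.2

lemma bend_unique_aux {κ : ℝ} {a b b' c : Pt} (hT : 0 < orient a c b) (hT' : 0 < orient a c b')
    (hb : dotAt a c b + κ * orient a c b = 0) (hb' : dotAt a c b' + κ * orient a c b' = 0)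
    (hv : 0 ≤ orient b a b') :
    b = b' ∨ ∃ x ∈ segment ℝ a b ∪ segment ℝ b c, x ∈ segment ℝ a b' ∪ segment ℝ b' c ∧
      0 < orient a c x := by
  by_cases hu : 0 ≤ orient c b b'
  · left
    obtain ⟨u, v, w, eu, ev, ew, hs, e0, e1⟩ := bary hT.ne' b'
    have u0 : 0 ≤ u := nonneg_of_mul_nonneg_left (eu ▸ hu) hT
    have v0 : 0 ≤ v := nonneg_of_mul_nonneg_left (ev ▸ hv) hT
    have w0 : 0 < w := pos_of_mul_pos_left (ew ▸ hT') hT.le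
    have hg := g_bary hs e0 e1 hb
    rw [hb'] at hg
    have s1 := sqd_nonneg a c
    have s2 : 0 < sqd a b := sqd_pos (by rintro rfl; rw [orient_self_left] at hT; exact hT.false)
    have s3 : 0 < sqd c b := sqd_pos (by rintro rfl; rw [orient_self_right] at hT; exact hT.false)
    have p1 : 0 ≤ u * v * sqd a c := by positivity
    have p2 : 0 ≤ u * w * sqd a b := by positivity
    have p3 : 0 ≤ v * w * sqd c b := by positivity
    have z2 : u * (w * sqd a b) = 0 := by linarith
    have z3 : v * (w * sqd c b) = 0 := by linarith
    have uz : u = 0 := (mul_eq_zero.1 z2).resolve_right (by positivity)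
    have vz : v = 0 := (mul_eq_zero.1 z3).resolve_right (by positivity)
    have wz : w = 1 := by linarith
    apply pt_ext <;> simp [e0, e1, uz, vz, wz]
  · right
    push Not at hu
    set s := orient a c b / (orient a c b - orient c b b') with hs
    have hden : 0 < orient a c b - orient c b b' := by linarith
    have s0 : 0 < s := by positivity
    have s1 : s ≤ 1 := by rw [hs, div_le_one hden]; linarith
    have sd : s * (orient a c b - orient c b b') = orient a c b := by
      rw [hs]; field_simp
    set x : Pt := a + s • (b' - a) with hx
    have e0 : x 0 = a 0 + s * (b' 0 - a 0) := by simp [hx]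
    have e1 : x 1 = a 1 + s * (b' 1 - a 1) := by simp [hx]
    have i1 : orient a c x = s * orient a c b' := by unfold orient; rw [e0, e1]; ring
    have i2 : orient b a x = s * orient b a b' := by unfold orient; rw [e0, e1]; ring
    have i3 : orient c b x = 0 := by
      have : orient c b x = (1 - s) * orient a c b + s * orient c b b' := by
        unfold orient; rw [e0, e1]; ring
      rw [this]; linarith
    have p1 : 0 < orient a c x := by rw [i1]; positivity
    refine ⟨x, mem_bend_of hT p1.le i3.ge (by rw [i2]; positivity) (Or.inl i3), Or.inl ?_, p1⟩
    rw [mem_segment_coord]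
    exact ⟨s, s0.le, s1, e0, e1⟩

lemma bend_unique {κ : ℝ} {a b b' c : Pt} (hT : 0 < orient a c b) (hT' : 0 < orient a c b')
    (hb : dotAt a c b + κ * orient a c b = 0) (hb' : dotAt a c b' + κ * orient a c b' = 0) :
    b = b' ∨ ∃ x ∈ segment ℝ a b ∪ segment ℝ b c, x ∈ segment ℝ a b' ∪ segment ℝ b' c ∧
      0 < orient a c x := by
  rcases le_total 0 (orient b a b') with h | h
  · exact bend_unique_aux hT hT' hb hb' h
  · have : 0 ≤ orient b' a b := by
      have : orient b' a b = - orient b a b' := by unfold orient; ring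
      linarith
    rcases bend_unique_aux hT' hT hb' hb this with h | ⟨x, h1, h2, h3⟩
    · exact Or.inl h.symm
    · exact Or.inr ⟨x, h2, h1, h3⟩

/-! ### Arcs as curves -/

/-- The arc in coordinates. -/
def arcSet (κ : ℝ) (a c : Pt) : Set Pt :=
  {x | 0 ≤ orient a c x ∧ dotAt a c x + κ * orient a c x = 0}

/-- Point with given local coordinates relative to `a c`. -/
def loc (a c : Pt) (X Y : ℝ) : Pt :=
  !₂[(a 0 + c 0) / 2 + X * ((c 0 - a 0) / 2) - Y * ((c 1 - a 1) / 2),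
    (a 1 + c 1) / 2 + X * ((c 1 - a 1) / 2) + Y * ((c 0 - a 0) / 2)]

lemma loc_zero (a c : Pt) (X Y : ℝ) : loc a c X Y 0 =
    (a 0 + c 0) / 2 + X * ((c 0 - a 0) / 2) - Y * ((c 1 - a 1) / 2) := by simp [loc]
lemma loc_one (a c : Pt) (X Y : ℝ) : loc a c X Y 1 =
    (a 1 + c 1) / 2 + X * ((c 1 - a 1) / 2) + Y * ((c 0 - a 0) / 2) := by simp [loc]

lemma orient_loc (a c : Pt) (X Y : ℝ) : orient a c (loc a c X Y) = Y * (sqd a c / 2) := by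
  unfold orient sqd; rw [loc_zero, loc_one]; ring

lemma dotAt_loc (a c : Pt) (X Y : ℝ) :
    dotAt a c (loc a c X Y) = (X ^ 2 + Y ^ 2 - 1) * (sqd a c / 4) := by
  unfold dotAt sqd; rw [loc_zero, loc_one]; ring

lemma exists_loc {a c : Pt} (hac : a ≠ c) (x : Pt) : ∃ X Y, x = loc a c X Y := by
  have hs := (sqd_pos hac).ne'
  refine ⟨((x 0 - (a 0 + c 0) / 2) * (c 0 - a 0) + (x 1 - (a 1 + c 1) / 2) * (c 1 - a 1)) * 2
    / sqd a c, ((x 1 - (a 1 + c 1) / 2) * (c 0 - a 0) - (x 0 - (a 0 + c 0) / 2) * (c 1 - a 1)) * 2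
    / sqd a c, pt_ext ?_ ?_⟩
  · rw [loc_zero]; field_simp; unfold sqd; ring
  · rw [loc_one]; field_simp; unfold sqd; ring

lemma arcSet_eq_image {κ : ℝ} (hκ : 0 < κ) {a c : Pt} (hac : a ≠ c) :
    arcSet κ a c = (fun X : ℝ => loc a c X (√(1 + κ ^ 2 - X ^ 2) - κ)) '' Icc (-1) 1 := by
  have hs := sqd_pos hac
  ext x
  constructor
  · rintro ⟨h1, h2⟩
    obtain ⟨X, Y, rfl⟩ := exists_loc hac x
    rw [orient_loc] at h1
    rw [orient_loc, dotAt_loc] at h2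
    have hY : 0 ≤ Y := nonneg_of_mul_nonneg_left h1 (by positivity)
    have h3 : X ^ 2 + Y ^ 2 - 1 + 2 * κ * Y = 0 := by
      apply mul_right_cancel₀ hs.ne'
      linear_combination 4 * h2
    refine ⟨X, ⟨by nlinarith [mul_nonneg hκ.le hY], by nlinarith [mul_nonneg hκ.le hY]⟩, ?_⟩
    have : √(1 + κ ^ 2 - X ^ 2) = Y + κ := by
      rw [show 1 + κ ^ 2 - X ^ 2 = (Y + κ) ^ 2 by linear_combination -h3]
      exact Real.sqrt_sq (by positivity)
    simp [this]
  · rintro ⟨X, ⟨hX1, hX2⟩, rfl⟩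
    have hX : X ^ 2 ≤ 1 := by nlinarith
    have hq : κ ≤ √(1 + κ ^ 2 - X ^ 2) := Real.le_sqrt_of_sq_le (by linarith)
    have hq2 : √(1 + κ ^ 2 - X ^ 2) ^ 2 = 1 + κ ^ 2 - X ^ 2 :=
      Real.sq_sqrt (by nlinarith [sq_nonneg κ])
    refine ⟨?_, ?_⟩
    · rw [orient_loc]; exact mul_nonneg (by linarith) (by positivity)
    · rw [orient_loc, dotAt_loc]
      linear_combination (sqd a c / 4) * hq2

lemma continuous_loc (a c : Pt) {f : ℝ → ℝ} (hf : Continuous f) :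
    Continuous (fun X => loc a c X (f X)) := by
  unfold loc
  refine (PiLp.continuous_toLp 2 _).comp ?_
  refine continuous_pi fun i => ?_
  fin_cases i
  · simp; fun_prop
  · simp; fun_prop

lemma arc_crv {κ : ℝ} (hκ : 0 < κ) {a c : Pt} (hac : a ≠ c) : Crv κ a c (arcSet κ a c) where
  left_mem := by simp [arcSet, orient_self_left, dotAt_self_left]
  right_mem := by simp [arcSet, orient_self_right, dotAt_self_right]
  sub_lens := by
    rintro x ⟨h1, h2⟩
    show dotAt a c x + κ * |orient a c x| ≤ 0
    rw [abs_of_nonneg h1]; exact h2.le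
  nonneg := fun x hx => hx.1
  ends := by
    rintro x ⟨h1, h2⟩ h
    exact eq_of_orient_dot hac h (by rw [h] at h2; simpa using h2)
  conn := by
    rw [arcSet_eq_image hκ hac]
    apply isPreconnected_Icc.image
    apply Continuous.continuousOn
    apply continuous_loc
    fun_prop
  sep := by
    refine ⟨fun x => dotAt a c x + κ * orient a c x,
      (continuous_dotAt a c).add (continuous_const.mul (continuous_orient a c)), ?_, ?_, ?_⟩
    · intro x hx h; exact ⟨hx.le, h⟩
    · intro x hx h; simpa [hx] using h
    · intro x hx h
      show dotAt a c x + κ * |orient a c x| ≤ 0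
      rwa [abs_of_pos hx]

/-- The isosceles apex. -/
def apex (κ : ℝ) (a c : Pt) : Pt := loc a c 0 (√(1 + κ ^ 2) - κ)

lemma apex_spec {κ : ℝ} (hκ : 0 < κ) {a c : Pt} (hac : a ≠ c) :
    0 < orient a c (apex κ a c) ∧
      dotAt a c (apex κ a c) + κ * orient a c (apex κ a c) = 0 := by
  have hs := sqd_pos hac
  have hq : κ < √(1 + κ ^ 2) := Real.lt_sqrt_of_sq_lt (by linarith)
  have hq2 : √(1 + κ ^ 2) ^ 2 = 1 + κ ^ 2 := Real.sq_sqrt (by positivity)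
  unfold apex
  rw [orient_loc, dotAt_loc]
  refine ⟨mul_pos (by linarith) (by positivity), ?_⟩
  linear_combination (sqd a c / 4) * hq2

/-! ### The threshold -/

/-- General position through orientations. -/
def GP (P : Finset Pt) : Prop :=
  ∀ p ∈ P, ∀ q ∈ P, ∀ r ∈ P, p ≠ q → p ≠ r → q ≠ r → orient p q r ≠ 0

lemma GenPos.gp {P : Finset Pt} (h : GenPos P) : GP P := by
  intro p hp q hq r hr h1 h2 h3 h0
  exact h p hp q hq r hr h1 h2 h3 ((collinear_iff_orient h1).2 h0)

/-- The parameter `κ` is large enough for the point set `P`. -/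
structure Good (κ : ℝ) (P : Finset Pt) : Prop where
  pos : 0 < κ
  fan : ∀ a ∈ P, ∀ c ∈ P, ∀ d ∈ P, orient a c d ≠ 0 →
    ∀ x, x ∈ lens κ a c → x ∈ lens κ a d → x = a
  vert : ∀ a ∈ P, ∀ c ∈ P, ∀ v ∈ P, v ∉ segment ℝ a c → v ∉ lens κ a c
  disj : ∀ a ∈ P, ∀ c ∈ P, ∀ p ∈ P, ∀ r ∈ P,
    (∀ x, x ∈ segment ℝ a c → x ∈ segment ℝ p r → False) →
    ∀ x, x ∈ lens κ a c → x ∈ lens κ p r → False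
  cr : ∀ a ∈ P, ∀ c ∈ P, ∀ p ∈ P, ∀ r ∈ P,
    (∀ x, x ∈ segment ℝ p r → orient a c x = 0 → 0 ≤ dotAt a c x → False) →
    ∀ x, x ∈ lens κ p r → orient a c x = 0 → 0 ≤ dotAt a c x → False

lemma eventually_good (P : Finset Pt) : ∀ᶠ κ : ℝ in Filter.atTop, Good κ P := by
  have h1 : ∀ᶠ κ : ℝ in Filter.atTop, ∀ a ∈ P, ∀ c ∈ P, ∀ d ∈ P, orient a c d ≠ 0 →
      ∀ x, x ∈ lens κ a c → x ∈ lens κ a d → x = a := by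
    simp only [Filter.eventually_all_finset, Filter.eventually_imp_distrib_left]
    intro a _ c _ d _ h
    exact eventually_lens_fan h
  have h2 : ∀ᶠ κ : ℝ in Filter.atTop, ∀ a ∈ P, ∀ c ∈ P, ∀ v ∈ P,
      v ∉ segment ℝ a c → v ∉ lens κ a c := by
    simp only [Filter.eventually_all_finset, Filter.eventually_imp_distrib_left]
    intro a _ c _ v _ h
    have := eventually_lens_disjoint (isClosed_singleton (x := v)) a c a c
      (by rintro x rfl hx _; exact h hx)
    filter_upwards [this] with κ hκ hv
    exact hκ v rfl hv hv
  have h3 : ∀ᶠ κ : ℝ in Filter.atTop, ∀ a ∈ P, ∀ c ∈ P, ∀ p ∈ P, ∀ r ∈ P,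
      (∀ x, x ∈ segment ℝ a c → x ∈ segment ℝ p r → False) →
      ∀ x, x ∈ lens κ a c → x ∈ lens κ p r → False := by
    simp only [Filter.eventually_all_finset, Filter.eventually_imp_distrib_left]
    intro a _ c _ p _ r _ h
    filter_upwards [eventually_lens_disjoint isClosed_univ a c p r (fun x _ => h x)] with κ hκ x
    exact hκ x (mem_univ x)
  have h4 : ∀ᶠ κ : ℝ in Filter.atTop, ∀ a ∈ P, ∀ c ∈ P, ∀ p ∈ P, ∀ r ∈ P,
      (∀ x, x ∈ segment ℝ p r → orient a c x = 0 → 0 ≤ dotAt a c x → False) →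
      ∀ x, x ∈ lens κ p r → orient a c x = 0 → 0 ≤ dotAt a c x → False := by
    simp only [Filter.eventually_all_finset, Filter.eventually_imp_distrib_left]
    intro a _ c _ p _ r _ h
    have hF : IsClosed ({x : Pt | orient a c x = 0} ∩ {x : Pt | 0 ≤ dotAt a c x}) :=
      (isClosed_eq (continuous_orient a c) continuous_const).inter
        (isClosed_le continuous_const (continuous_dotAt a c))
    filter_upwards [eventually_lens_disjoint hF p r p r
      (fun x hx hs _ => h x hs hx.1 hx.2)] with κ hκ x hx h1 h2
    exact hκ x ⟨h1, h2⟩ hx hx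
  filter_upwards [Filter.eventually_gt_atTop 0, h1, h2, h3, h4] with κ a b c d e
  exact ⟨a, b, c, d, e⟩

/-! ### Segments on points in general position -/

lemma seg_fan {a c r x : Pt} (h : orient a c r ≠ 0) (h1 : x ∈ segment ℝ a c)
    (h2 : x ∈ segment ℝ a r) : x = a := by
  have h1 := (mem_segment_iff'.1 h1).1
  obtain ⟨t, -, -, e0, e1⟩ := mem_segment_coord.1 h2
  have : orient a c x = t * orient a c r := by unfold orient; rw [e0, e1]; ring
  rw [this] at h1
  have ht := (mul_eq_zero.1 h1).resolve_right h
  apply pt_ext <;> simp [e0, e1, ht]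

lemma GP.vert_seg {P : Finset Pt} (hP : GP P) {a c v : Pt} (ha : a ∈ P) (hc : c ∈ P) (hv : v ∈ P)
    (hac : a ≠ c) (h : v ∈ segment ℝ a c) : v = a ∨ v = c := by
  by_contra hne
  push Not at hne
  exact hP a ha c hc v hv hac hne.1.symm hne.2.symm (mem_segment_iff'.1 h).1

lemma GP.cross_data {P : Finset Pt} (hP : GP P) {a c p r x : Pt} (ha : a ∈ P) (hc : c ∈ P)
    (hp : p ∈ P) (hr : r ∈ P) (hac : a ≠ c) (hpr : p ≠ r) (hne : s(a, c) ≠ s(p, r))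
    (hx1 : x ∈ segment ℝ a c) (hx2 : x ∈ segment ℝ p r)
    (hx3 : ¬ ((x = a ∨ x = c) ∧ (x = p ∨ x = r))) :
    orient a c p * orient a c r < 0 ∧ p ∉ segment ℝ a c ∧ r ∉ segment ℝ a c ∧
      ∀ y ∈ segment ℝ p r, orient a c y = 0 → 0 ≤ dotAt a c y → False := by
  have n1 : a ≠ p := by
    rintro rfl
    have hcr : c ≠ r := by rintro rfl; exact hne rfl
    have := seg_fan (hP a ha c hc r hr hac hpr hcr) hx1 hx2
    exact hx3 ⟨Or.inl this, Or.inl this⟩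
  have n2 : a ≠ r := by
    rintro rfl
    have hcr : c ≠ p := by rintro rfl; exact hne Sym2.eq_swap
    have := seg_fan (hP a ha c hc p hp hac n1 hcr) hx1 (segment_symm ℝ p a ▸ hx2)
    exact hx3 ⟨Or.inl this, Or.inr this⟩
  have n3 : c ≠ p := by
    rintro rfl
    have := seg_fan (hP c hc a ha r hr hac.symm hpr n2) (segment_symm ℝ a c ▸ hx1) hx2
    exact hx3 ⟨Or.inr this, Or.inl this⟩
  have n4 : c ≠ r := by
    rintro rfl
    have := seg_fan (hP c hc a ha p hp hac.symm n3 n1) (segment_symm ℝ a c ▸ hx1)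
      (segment_symm ℝ p c ▸ hx2)
    exact hx3 ⟨Or.inr this, Or.inr this⟩
  have op := hP a ha c hc p hp hac n1 n3
  have or' := hP a ha c hc r hr hac n2 n4
  obtain ⟨hxo, hxd⟩ := mem_segment_iff'.1 hx1
  obtain ⟨t, t0, t1, e0, e1⟩ := mem_segment_coord.1 hx2
  have ix : orient a c x = (1 - t) * orient a c p + t * orient a c r := by
    unfold orient; rw [e0, e1]; ring
  have hneg : orient a c p * orient a c r < 0 := by
    by_contra hh
    have hpos : 0 < orient a c p * orient a c r :=
      lt_of_le_of_ne (not_lt.1 hh) (mul_ne_zero op or').symm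
    have hz : (1 - t) * orient a c p ^ 2 + t * (orient a c p * orient a c r) = 0 := by
      rw [hxo] at ix
      linear_combination (- orient a c p) * ix
    have q1 : 0 ≤ (1 - t) * orient a c p ^ 2 := mul_nonneg (by linarith) (sq_nonneg _)
    have q2 : 0 ≤ t * (orient a c p * orient a c r) := mul_nonneg t0 hpos.le
    have q3 : t * (orient a c p * orient a c r) = 0 := by linarith
    have ht : t = 0 := (mul_eq_zero.1 q3).resolve_right hpos.ne'
    rw [ht] at hz
    have : orient a c p ^ 2 = 0 := by linarith
    exact op (pow_eq_zero_iff (two_ne_zero) |>.1 this)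
  refine ⟨hneg, fun h => op (mem_segment_iff'.1 h).1, fun h => or' (mem_segment_iff'.1 h).1, ?_⟩
  intro y hy hyo hyd
  obtain ⟨u, u0, u1, f0, f1⟩ := mem_segment_coord.1 hy
  have iy : orient a c y = (1 - u) * orient a c p + u * orient a c r := by
    unfold orient; rw [f0, f1]; ring
  have hd : orient a c r - orient a c p ≠ 0 := by
    intro h
    have : orient a c r = orient a c p := by linarith
    rw [this] at hneg
    nlinarith [sq_nonneg (orient a c p)]
  have htu : u - t = 0 := by
    rw [hyo] at iy; rw [hxo] at ix
    refine (mul_eq_zero.1 (?_ : (u - t) * (orient a c r - orient a c p) = 0)).resolve_right hd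
    linear_combination ix - iy
  have htu : u = t := by linarith
  have hyx : y = x := by apply pt_ext <;> simp [e0, e1, f0, f1, htu]
  subst hyx
  rcases eq_of_orient_dot hac hyo (le_antisymm hxd hyd) with rfl | rfl
  · rcases hP.vert_seg hp hr ha hpr hy with h | h
    · exact n1 h
    · exact n2 h
  · rcases hP.vert_seg hp hr hc hpr hy with h | h
    · exact n3 h
    · exact n4 h

lemma core_cross {P : Finset Pt} (hP : GP P) {κ : ℝ} (hκ : Good κ P) {a c p r x : Pt}
    (ha : a ∈ P) (hc : c ∈ P)
    (hp : p ∈ P) (hr : r ∈ P) (hac : a ≠ c) (hpr : p ≠ r) (hne : s(a, c) ≠ s(p, r))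
    (hx1 : x ∈ segment ℝ a c) (hx2 : x ∈ segment ℝ p r)
    (hx3 : ¬ ((x = a ∨ x = c) ∧ (x = p ∨ x = r))) {S T : Set Pt}
    (hS : Crv κ a c S) (hT : IsPreconnected T) (hpT : p ∈ T) (hrT : r ∈ T)
    (hTl : T ⊆ lens κ p r) : ∃ y ∈ S, y ∈ T ∧ 0 < orient a c y := by
  obtain ⟨hneg, hps, hrs, hF⟩ := hP.cross_data ha hc hp hr hac hpr hne hx1 hx2 hx3
  have hTF : ∀ x ∈ T, orient a c x = 0 → 0 ≤ dotAt a c x → False :=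
    fun x hx => hκ.cr a ha c hc p hp r hr hF x (hTl hx)
  rcases mul_neg_iff.1 hneg with ⟨h1, h2⟩ | ⟨h1, h2⟩
  · exact hS.cross hT hrT hpT h2 h1 (hκ.vert a ha c hc p hp hps) hTF
  · exact hS.cross hT hpT hrT h1 h2 (hκ.vert a ha c hc r hr hrs) hTF

lemma lens_inter {P : Finset Pt} (hP : GP P) {κ : ℝ} (hκ : Good κ P) {a c p r x : Pt}
    (ha : a ∈ P) (hc : c ∈ P)
    (hp : p ∈ P) (hr : r ∈ P) (hac : a ≠ c) (hpr : p ≠ r) (hne : s(a, c) ≠ s(p, r))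
    (hseg : ∀ x ∈ segment ℝ a c, x ∈ segment ℝ p r → (x = a ∨ x = c) ∧ (x = p ∨ x = r))
    (h1 : x ∈ lens κ a c) (h2 : x ∈ lens κ p r) : (x = a ∨ x = c) ∧ (x = p ∨ x = r) := by
  by_cases n1 : a = p
  · subst n1
    have hcr : c ≠ r := by rintro rfl; exact hne rfl
    have := hκ.fan a ha c hc r hr (hP a ha c hc r hr hac hpr hcr) x h1 h2
    exact ⟨Or.inl this, Or.inl this⟩
  by_cases n2 : a = r
  · subst n2
    have hcr : c ≠ p := by rintro rfl; exact hne Sym2.eq_swap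
    have := hκ.fan a ha c hc p hp (hP a ha c hc p hp hac n1 hcr) x h1 (lens_swap κ p a ▸ h2)
    exact ⟨Or.inl this, Or.inr this⟩
  by_cases n3 : c = p
  · subst n3
    have := hκ.fan c hc a ha r hr (hP c hc a ha r hr hac.symm hpr n2) x (lens_swap κ a c ▸ h1) h2
    exact ⟨Or.inr this, Or.inl this⟩
  by_cases n4 : c = r
  · subst n4
    have := hκ.fan c hc a ha p hp (hP c hc a ha p hp hac.symm n3 n1) x (lens_swap κ a c ▸ h1)
      (lens_swap κ p c ▸ h2)
    exact ⟨Or.inr this, Or.inr this⟩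
  exfalso
  refine hκ.disj a ha c hc p hp r hr (fun y hy1 hy2 => ?_) x h1 h2
  obtain ⟨h | h, hh | hh⟩ := hseg y hy1 hy2
  · exact n1 (h ▸ hh)
  · exact n2 (h ▸ hh)
  · exact n3 (h ▸ hh)
  · exact n4 (h ▸ hh)

/-! ### Families of edges -/

/-- What bends and arcs have in common. -/
structure Fam (κ : ℝ) (isE : Pt × Pt × Pt → Prop) (img : Pt × Pt × Pt → Set Pt) : Prop where
  orient_ne : ∀ a b c, isE (a, b, c) → orient a c b ≠ 0
  symm : ∀ a b c, isE (a, b, c) → isE (c, b, a)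
  img_symm : ∀ a b c, isE (a, b, c) → img (c, b, a) = img (a, b, c)
  mid_mem : ∀ a b c, isE (a, b, c) → b ∈ img (a, b, c)
  crv : ∀ a b c, isE (a, b, c) → 0 < orient a c b → Crv κ a c (img (a, b, c))
  uniq : ∀ a b b' c, isE (a, b, c) → isE (a, b', c) → 0 < orient a c b → 0 < orient a c b' →
    img (a, b, c) = img (a, b', c) ∨
      ∃ x ∈ img (a, b, c), x ∈ img (a, b', c) ∧ 0 < orient a c x
  apex : ∀ a c, a ≠ c → isE (a, apex κ a c, c)

/-- Generic plane multigraph. -/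
def PM (isE : Pt × Pt × Pt → Prop) (img : Pt × Pt × Pt → Set Pt) (V : Finset Pt)
    (E : Finset (Pt × Pt × Pt)) : Prop :=
  (∀ e ∈ E, isE e ∧ e.1 ∈ V ∧ e.2.2 ∈ V) ∧
  (∀ e ∈ E, ∀ f ∈ E, e ≠ f → img e ≠ img f) ∧
  (∀ e ∈ E, ∀ v ∈ V, (v : Pt) ∈ img e → (v : Pt) ∈ edgeEndpoints e) ∧
  (∀ e ∈ E, ∀ f ∈ E, e ≠ f → img e ∩ img f ⊆ edgeEndpoints e ∩ edgeEndpoints f)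

/-- Generic plane graph. -/
def PG (isE : Pt × Pt × Pt → Prop) (img : Pt × Pt × Pt → Set Pt) (V : Finset Pt)
    (E : Finset (Pt × Pt × Pt)) : Prop :=
  PM isE img V E ∧ ∀ e ∈ E, ∀ f ∈ E, e ≠ f → edgeEndpoints e ≠ edgeEndpoints f

lemma PSLG_card_le {P : Finset Pt} {E : Finset (Pt × Pt)} (h : IsPSLG P E) :
    E.card ≤ (P ×ˢ P).card :=
  Finset.card_le_card fun e he => Finset.mem_product.2 ⟨(h.1 e he).1, (h.1 e he).2.1⟩

lemma card_le_M {P : Finset Pt} {E : Finset (Pt × Pt)} (h : IsPSLG P E) : E.card ≤ M P :=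
  le_csSup ⟨(P ×ˢ P).card, by rintro m ⟨E, hE, rfl⟩; exact PSLG_card_le hE⟩ ⟨E, h, rfl⟩

lemma exists_M (P : Finset Pt) : ∃ E : Finset (Pt × Pt), IsPSLG P E ∧ E.card = M P :=
  Nat.sSup_mem (s := {m : ℕ | ∃ E : Finset (Pt × Pt), IsPSLG P E ∧ E.card = m})
    ⟨0, ∅, by simp [IsPSLG], rfl⟩
    ⟨(P ×ˢ P).card, by rintro m ⟨E, hE, rfl⟩; exact PSLG_card_le hE⟩

section generic

variable {κ : ℝ} {isE : Pt × Pt × Pt → Prop} {img : Pt × Pt × Pt → Set Pt} {P : Finset Pt}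

lemma Fam.crv' (hF : Fam κ isE img) {a b c : Pt} (h : isE (a, b, c)) :
    Crv κ a c (img (a, b, c)) ∨ Crv κ c a (img (a, b, c)) := by
  rcases lt_or_gt_of_ne (hF.orient_ne a b c h) with h' | h'
  · right
    rw [← hF.img_symm a b c h]
    exact hF.crv _ _ _ (hF.symm _ _ _ h) (by rw [orient_swap]; linarith)
  · left; exact hF.crv _ _ _ h h'

lemma edge_info (hF : Fam κ isE img) {E : Finset (Pt × Pt × Pt)} (hE : PM isE img P E)
    {e : Pt × Pt × Pt} (he : e ∈ E) {a c : Pt} (hac : s(a, c) = s(e.1, e.2.2)) :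
    (Crv κ a c (img e) ∨ Crv κ c a (img e)) ∧ edgeEndpoints e = {a, c} ∧ a ∈ P ∧ c ∈ P ∧ a ≠ c ∧
      isE (a, e.2.1, c) ∧ img (a, e.2.1, c) = img e := by
  obtain ⟨p, b, r⟩ := e
  obtain ⟨h1, h2, h3⟩ := hE.1 _ he
  have hne := ne_of_orient (hF.orient_ne _ _ _ h1)
  simp only at hac h2 h3
  rcases Sym2.eq_iff.1 hac with ⟨rfl, rfl⟩ | ⟨rfl, rfl⟩
  · exact ⟨hF.crv' h1, rfl, h2, h3, hne, h1, rfl⟩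
  · exact ⟨(hF.crv' h1).symm, Set.pair_comm _ _, h3, h2, hne.symm, hF.symm _ _ _ h1,
      hF.img_symm _ _ _ h1⟩

lemma PM_noncross (hP : GP P) (hκ : Good κ P) (hF : Fam κ isE img) {E : Finset (Pt × Pt × Pt)}
    (hE : PM isE img P E) {e f : Pt × Pt × Pt} (he : e ∈ E) (hf : f ∈ E) {a c p r : Pt}
    (hac : s(a, c) = s(e.1, e.2.2)) (hpr : s(p, r) = s(f.1, f.2.2)) (hne : s(a, c) ≠ s(p, r))
    {x : Pt} (hx1 : x ∈ segment ℝ a c) (hx2 : x ∈ segment ℝ p r) :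
    (x = a ∨ x = c) ∧ (x = p ∨ x = r) := by
  by_contra hx3
  obtain ⟨c1, ee, ha, hc, nac, -, -⟩ := edge_info hF hE he hac
  obtain ⟨c2, ef, hp, hr, npr, -, -⟩ := edge_info hF hE hf hpr
  have hef : e ≠ f := by rintro rfl; exact hne (hac.trans hpr.symm)
  have T : IsPreconnected (img f) ∧ p ∈ img f ∧ r ∈ img f ∧ img f ⊆ lens κ p r := by
    rcases c2 with h | h
    · exact ⟨h.conn, h.left_mem, h.right_mem, h.sub_lens⟩
    · exact ⟨h.conn, h.right_mem, h.left_mem, lens_swap κ p r ▸ h.sub_lens⟩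
  have key : ∃ y ∈ img e, y ∈ img f ∧ orient a c y ≠ 0 := by
    rcases c1 with h | h
    · obtain ⟨y, h1, h2, h3⟩ := core_cross hP hκ ha hc hp hr nac npr hne hx1 hx2 hx3 h T.1 T.2.1
        T.2.2.1 T.2.2.2
      exact ⟨y, h1, h2, h3.ne'⟩
    · obtain ⟨y, h1, h2, h3⟩ := core_cross hP hκ hc ha hp hr nac.symm npr
        (by rwa [Sym2.eq_swap]) (segment_symm ℝ a c ▸ hx1) hx2 (by rwa [or_comm (a := x = c)])
        h T.1 T.2.1 T.2.2.1 T.2.2.2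
      refine ⟨y, h1, h2, ?_⟩
      rw [orient_swap] at h3
      linarith
  obtain ⟨y, h1, h2, h3⟩ := key
  have := (hE.2.2.2 e he f hf hef ⟨h1, h2⟩).1
  rw [ee] at this
  rcases this with rfl | rfl
  · exact h3 (orient_self_left _ _)
  · exact h3 (orient_self_right _ _)

open Classical in
lemma upper_pairs (hP : GP P) (hκ : Good κ P) (hF : Fam κ isE img) {E : Finset (Pt × Pt × Pt)}
    (hE : PM isE img P E) : (E.image (fun e => s(e.1, e.2.2))).card ≤ M P := by
  have hrep : ∀ z : Sym2 Pt, ∃ q : Pt × Pt, s(q.1, q.2) = z := by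
    intro z
    induction z using Sym2.ind with
    | _ a c => exact ⟨(a, c), rfl⟩
  choose rep hrep using hrep
  have hinj : Function.Injective rep := fun z z' h => by rw [← hrep z, ← hrep z', h]
  rw [← Finset.card_image_of_injective _ hinj]
  apply card_le_M
  have hmem : ∀ q ∈ (E.image (fun e => s(e.1, e.2.2))).image rep,
      ∃ e ∈ E, s(q.1, q.2) = s(e.1, e.2.2) := by
    intro q hq
    simp only [Finset.mem_image] at hq
    obtain ⟨z, ⟨e, he, rfl⟩, rfl⟩ := hq
    exact ⟨e, he, hrep _⟩
  have hsne : ∀ q ∈ (E.image (fun e => s(e.1, e.2.2))).image rep,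
      ∀ q' ∈ (E.image (fun e => s(e.1, e.2.2))).image rep, q ≠ q' →
      s(q.1, q.2) ≠ s(q'.1, q'.2) := by
    intro q hq q' hq' hne h
    simp only [Finset.mem_image] at hq hq'
    obtain ⟨z, -, rfl⟩ := hq
    obtain ⟨z', -, rfl⟩ := hq'
    rw [hrep, hrep] at h
    exact hne (by rw [h])
  have h1 : ∀ q ∈ (E.image (fun e => s(e.1, e.2.2))).image rep,
      q.1 ∈ P ∧ q.2 ∈ P ∧ q.1 ≠ q.2 := by
    intro q hq
    obtain ⟨e, he, h⟩ := hmem q hq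
    obtain ⟨-, -, h1, h2, h3, -⟩ := edge_info hF hE he h
    exact ⟨h1, h2, h3⟩
  refine ⟨h1, ?_, ?_, ?_⟩
  · intro q hq q' hq' hne heq
    obtain ⟨a1, a2, a3⟩ := h1 q hq
    obtain ⟨b1, b2, b3⟩ := h1 q' hq'
    have u1 := hP.vert_seg b1 b2 a1 b3 (heq ▸ left_mem_segment ℝ q.1 q.2)
    have u2 := hP.vert_seg b1 b2 a2 b3 (heq ▸ right_mem_segment ℝ q.1 q.2)
    apply hsne q hq q' hq' hne
    rw [Sym2.eq_iff]
    rcases u1 with u1 | u1 <;> rcases u2 with u2 | u2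
    · exact absurd (u1.trans u2.symm) a3
    · exact Or.inl ⟨u1, u2⟩
    · exact Or.inr ⟨u1, u2⟩
    · exact absurd (u1.trans u2.symm) a3
  · intro q hq v hv hvs
    obtain ⟨a1, a2, a3⟩ := h1 q hq
    exact hP.vert_seg a1 a2 hv a3 hvs
  · rintro q hq q' hq' hne x ⟨hx1, hx2⟩
    obtain ⟨e, he, h⟩ := hmem q hq
    obtain ⟨f, hf, h'⟩ := hmem q' hq'
    exact PM_noncross hP hκ hF hE he hf h h' (hsne q hq q' hq' hne) hx1 hx2

lemma PM_uniq (hF : Fam κ isE img) {E : Finset (Pt × Pt × Pt)}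
    (hE : PM isE img P E) {e f : Pt × Pt × Pt} (he : e ∈ E) (hf : f ∈ E) {a c : Pt}
    (h1 : s(a, c) = s(e.1, e.2.2)) (h2 : s(a, c) = s(f.1, f.2.2))
    (o1 : 0 < orient a c e.2.1) (o2 : 0 < orient a c f.2.1) : e = f := by
  by_contra hne
  obtain ⟨-, ee, -, -, -, i1, j1⟩ := edge_info hF hE he h1
  obtain ⟨-, -, -, -, -, i2, j2⟩ := edge_info hF hE hf h2
  rcases hF.uniq _ _ _ _ i1 i2 o1 o2 with h | ⟨x, hx1, hx2, hx3⟩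
  · rw [j1, j2] at h
    exact hE.2.1 e he f hf hne h
  · rw [j1] at hx1; rw [j2] at hx2
    have := (hE.2.2.2 e he f hf hne ⟨hx1, hx2⟩).1
    rw [ee] at this
    rcases this with rfl | rfl
    · rw [orient_self_left] at hx3; exact hx3.false
    · rw [orient_self_right] at hx3; exact hx3.false

open Classical in
lemma upper_multi (hP : GP P) (hκ : Good κ P) (hF : Fam κ isE img) {E : Finset (Pt × Pt × Pt)}
    (hE : PM isE img P E) : E.card ≤ 2 * M P := by
  refine le_trans (Finset.card_le_mul_card_image (f := fun e => s(e.1, e.2.2)) E 2 ?_)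
    (Nat.mul_le_mul_left 2 (upper_pairs hP hκ hF hE))
  intro z _
  induction z using Sym2.ind with
  | _ a c =>
    have h2 : (Finset.univ : Finset Bool).card = 2 := by simp
    refine le_trans ?_ h2.le
    refine Finset.card_le_card_of_injOn (fun e => decide (0 < orient a c e.2.1))
      (fun _ _ => Finset.mem_coe.2 (Finset.mem_univ _)) ?_
    intro e he f hf hef
    simp only [Finset.coe_filter, Set.mem_ofPred_eq] at he hf
    simp only [decide_eq_decide] at hef
    by_cases h : 0 < orient a c e.2.1
    · exact PM_uniq hF hE he.1 hf.1 he.2.symm hf.2.symm h (hef.1 h)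
    · have h' : ¬ 0 < orient a c f.2.1 := fun hh => h (hef.2 hh)
      obtain ⟨-, -, -, -, -, i1, -⟩ := edge_info hF hE he.1 he.2.symm
      obtain ⟨-, -, -, -, -, i2, -⟩ := edge_info hF hE hf.1 hf.2.symm
      have o1 := lt_of_le_of_ne (not_lt.1 h) (hF.orient_ne _ _ _ i1)
      have o2 := lt_of_le_of_ne (not_lt.1 h') (hF.orient_ne _ _ _ i2)
      exact PM_uniq hF hE he.1 hf.1 (Sym2.eq_swap.trans he.2.symm) (Sym2.eq_swap.trans hf.2.symm)
        (by rw [orient_swap]; linarith) (by rw [orient_swap]; linarith)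

open Classical in
lemma upper_graph (hP : GP P) (hκ : Good κ P) (hF : Fam κ isE img) {E : Finset (Pt × Pt × Pt)}
    (hE : PG isE img P E) : E.card ≤ M P := by
  refine le_trans (le_of_eq ?_) (upper_pairs hP hκ hF hE.1)
  symm
  apply Finset.card_image_of_injOn
  intro e he f hf h
  by_contra hne
  refine hE.2 e he f hf hne ?_
  unfold edgeEndpoints
  rcases Sym2.eq_iff.1 h with ⟨h1, h2⟩ | ⟨h1, h2⟩
  · rw [h1, h2]
  · rw [h1, h2, Set.pair_comm]

/-- The canonical edge for an ordered pair. -/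
def mkEdge (κ : ℝ) (q : Pt × Pt) : Pt × Pt × Pt := (q.1, apex κ q.1 q.2, q.2)

lemma mkEdge_inj (κ : ℝ) : Function.Injective (mkEdge κ) := by
  rintro ⟨a, c⟩ ⟨p, r⟩ h
  simp only [mkEdge, Prod.mk.injEq] at h
  rw [h.1, h.2.2]

open Classical in
lemma lower_PM (hP : GP P) (hκ : Good κ P) (hF : Fam κ isE img) {Q : Finset (Pt × Pt)}
    (hQ : ∀ q ∈ Q, q.1 ∈ P ∧ q.2 ∈ P ∧ q.1 ≠ q.2)
    (hQ2 : ∀ q ∈ Q, ∀ q' ∈ Q, s(q.1, q.2) ≠ s(q'.1, q'.2) → ∀ x ∈ segment ℝ q.1 q.2,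
      x ∈ segment ℝ q'.1 q'.2 → (x = q.1 ∨ x = q.2) ∧ (x = q'.1 ∨ x = q'.2)) :
    PM isE img P (Q.image (mkEdge κ)) := by
  have hE : ∀ q ∈ Q, isE (mkEdge κ q) := fun q hq => hF.apex _ _ (hQ q hq).2.2
  have hO : ∀ q ∈ Q, 0 < orient q.1 q.2 (apex κ q.1 q.2) :=
    fun q hq => (apex_spec hκ.pos (hQ q hq).2.2).1
  have hC : ∀ q ∈ Q, Crv κ q.1 q.2 (img (mkEdge κ q)) :=
    fun q hq => hF.crv _ _ _ (hE q hq) (hO q hq)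
  have h4 : ∀ q ∈ Q, ∀ q' ∈ Q, q ≠ q' → ∀ x ∈ img (mkEdge κ q), x ∈ img (mkEdge κ q') →
      (x = q.1 ∨ x = q.2) ∧ (x = q'.1 ∨ x = q'.2) := by
    intro q hq q' hq' hne x hx1 hx2
    obtain ⟨a1, a2, a3⟩ := hQ q hq
    obtain ⟨b1, b2, b3⟩ := hQ q' hq'
    by_cases hs : s(q.1, q.2) = s(q'.1, q'.2)
    · rcases Sym2.eq_iff.1 hs with ⟨h1, h2⟩ | ⟨h1, h2⟩
      · exact absurd (Prod.ext h1 h2) hne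
      · have n1 := (hC q hq).nonneg x hx1
        have n2 := (hC q' hq').nonneg x hx2
        rw [← h1, ← h2, orient_swap] at n2
        have := (hC q hq).ends x hx1 (by linarith)
        refine ⟨this, ?_⟩
        rw [← h1, ← h2]; exact this.symm
    · exact lens_inter hP hκ a1 a2 b1 b2 a3 b3 hs (hQ2 q hq q' hq' hs)
        ((hC q hq).sub_lens hx1) ((hC q' hq').sub_lens hx2)
  refine ⟨?_, ?_, ?_, ?_⟩
  · intro e he
    obtain ⟨q, hq, rfl⟩ := Finset.mem_image.1 he
    exact ⟨hE q hq, (hQ q hq).1, (hQ q hq).2.1⟩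
  · intro e he f hf hne heq
    obtain ⟨q, hq, rfl⟩ := Finset.mem_image.1 he
    obtain ⟨q', hq', rfl⟩ := Finset.mem_image.1 hf
    have hb := hF.mid_mem _ _ _ (hE q hq)
    have ho := hO q hq
    rcases (h4 q hq q' hq' (fun h => hne (by rw [h])) _ hb (heq ▸ hb)).1 with h | h
    · rw [h, orient_self_left] at ho; exact ho.false
    · rw [h, orient_self_right] at ho; exact ho.false
  · intro e he v hv hvi
    obtain ⟨q, hq, rfl⟩ := Finset.mem_image.1 he
    obtain ⟨a1, a2, a3⟩ := hQ q hq
    by_contra hcon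
    refine hκ.vert _ a1 _ a2 v hv (fun h => hcon ?_) ((hC q hq).sub_lens hvi)
    exact hP.vert_seg a1 a2 hv a3 h
  · rintro e he f hf hne x ⟨hx1, hx2⟩
    obtain ⟨q, hq, rfl⟩ := Finset.mem_image.1 he
    obtain ⟨q', hq', rfl⟩ := Finset.mem_image.1 hf
    exact h4 q hq q' hq' (fun h => hne (by rw [h])) x hx1 hx2

lemma PSLG_sym {E : Finset (Pt × Pt)} (hE : IsPSLG P E) {q q' : Pt × Pt} (hq : q ∈ E)
    (hq' : q' ∈ E) (h : s(q.1, q.2) = s(q'.1, q'.2)) : q = q' := by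
  by_contra hne
  refine hE.2.1 q hq q' hq' hne ?_
  rcases Sym2.eq_iff.1 h with ⟨h1, h2⟩ | ⟨h1, h2⟩
  · rw [h1, h2]
  · rw [h1, h2, segment_symm]

open Classical in
lemma lower_graph (hP : GP P) (hκ : Good κ P) (hF : Fam κ isE img) :
    ∃ E : Finset (Pt × Pt × Pt), PG isE img P E ∧ E.card = M P := by
  obtain ⟨E0, hE0, hM⟩ := exists_M P
  refine ⟨E0.image (mkEdge κ), ⟨lower_PM hP hκ hF hE0.1 ?_, ?_⟩, ?_⟩
  · intro q hq q' hq' hne x h1 h2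
    exact hE0.2.2.2 q hq q' hq' (by rintro rfl; exact hne rfl) ⟨h1, h2⟩
  · intro e he f hf hne heq
    obtain ⟨q, hq, rfl⟩ := Finset.mem_image.1 he
    obtain ⟨q', hq', rfl⟩ := Finset.mem_image.1 hf
    apply hne
    have heq : ({q.1, q.2} : Set Pt) = {q'.1, q'.2} := heq
    rw [PSLG_sym hE0 hq hq' (Sym2.eq_iff.2 (Set.pair_eq_pair_iff.1 heq))]
  · rw [Finset.card_image_of_injective _ (mkEdge_inj κ), hM]

open Classical in
lemma lower_multi (hP : GP P) (hκ : Good κ P) (hF : Fam κ isE img) :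
    ∃ E : Finset (Pt × Pt × Pt), PM isE img P E ∧ E.card = 2 * M P := by
  obtain ⟨E0, hE0, hM⟩ := exists_M P
  have hm : ∀ q ∈ E0 ∪ E0.image Prod.swap, ∃ r ∈ E0, s(q.1, q.2) = s(r.1, r.2) ∧
      segment ℝ q.1 q.2 = segment ℝ r.1 r.2 ∧
      ∀ x, (x = r.1 ∨ x = r.2) → (x = q.1 ∨ x = q.2) := by
    intro q hq
    rcases Finset.mem_union.1 hq with h | h
    · exact ⟨q, h, rfl, rfl, fun x => id⟩
    · obtain ⟨r, hr, rfl⟩ := Finset.mem_image.1 h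
      exact ⟨r, hr, Sym2.eq_swap, segment_symm _ _ _, fun x => Or.symm⟩
  refine ⟨(E0 ∪ E0.image Prod.swap).image (mkEdge κ), lower_PM hP hκ hF ?_ ?_, ?_⟩
  · intro q hq
    rcases Finset.mem_union.1 hq with h | h
    · exact hE0.1 q h
    · obtain ⟨r, hr, rfl⟩ := Finset.mem_image.1 h
      obtain ⟨a, b, c⟩ := hE0.1 r hr
      exact ⟨b, a, c.symm⟩
  · intro q hq q' hq' hne x h1 h2
    obtain ⟨r, hr, e1, e2, e3⟩ := hm q hq
    obtain ⟨r', hr', f1, f2, f3⟩ := hm q' hq'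
    rw [e2] at h1; rw [f2] at h2
    have := hE0.2.2.2 r hr r' hr' (by rintro rfl; exact hne (e1.trans f1.symm)) ⟨h1, h2⟩
    exact ⟨e3 x this.1, f3 x this.2⟩
  · rw [Finset.card_image_of_injective _ (mkEdge_inj κ), Finset.card_union_of_disjoint,
      Finset.card_image_of_injective _ Prod.swap_injective, hM, two_mul]
    rw [Finset.disjoint_left]
    intro q hq hq'
    obtain ⟨r, hr, rfl⟩ := Finset.mem_image.1 hq'
    have := PSLG_sym hE0 hq hr Sym2.eq_swap
    exact (hE0.1 r hr).2.2 (congrArg Prod.snd this)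

end generic

/-! ### Bends and arcs are families -/

lemma bend_fam {α : ℝ} (h1 : π / 2 < α) (h2 : α < π) :
    Fam (-(cos α / sin α)) (IsBendEdge α) bendImage := by
  have hs : 0 < sin α := sin_pos_of_pos_of_lt_pi (by linarith [pi_pos]) h2
  have hc : cos α < 0 := cos_neg_of_pi_div_two_lt_of_lt h1 (by linarith [pi_pos])
  have hκ : 0 < -(cos α / sin α) := by
    have := div_neg_of_neg_of_pos hc hs
    linarith
  have hg : ∀ a b c, IsBendEdge α (a, b, c) → 0 < orient a c b →
      dotAt a c b + -(cos α / sin α) * orient a c b = 0 := by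
    intro a b c h ho
    have := ((angle_iff h1 h2 a b c).1 h.2).2
    rwa [abs_of_pos ho] at this
  refine ⟨?_, ?_, ?_, ?_, ?_, ?_, ?_⟩
  · intro a b c h
    exact ((angle_iff h1 h2 a b c).1 h.2).1
  · intro a b c h
    exact ⟨h.1.symm, (EuclideanGeometry.angle_comm _ _ _).trans h.2⟩
  · intro a b c _
    show segment ℝ c b ∪ segment ℝ b a = segment ℝ a b ∪ segment ℝ b c
    rw [segment_symm ℝ c b, segment_symm ℝ b a, Set.union_comm]
  · intro a b c _
    exact Or.inl (right_mem_segment ..)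
  · intro a b c h ho
    exact bend_crv ho (hg a b c h ho)
  · intro a b b' c h h' ho ho'
    rcases bend_unique ho ho' (hg _ _ _ h ho) (hg _ _ _ h' ho') with rfl | h
    · exact Or.inl rfl
    · exact Or.inr h
  · intro a c hac
    obtain ⟨u, v⟩ := apex_spec hκ hac
    refine ⟨hac, (angle_iff h1 h2 _ _ _).2 ⟨u.ne', ?_⟩⟩
    rwa [abs_of_pos u]

lemma arc_fam {α : ℝ} (h1 : π / 2 < α) (h2 : α < π) :
    Fam (-(cos α / sin α)) (IsArcEdge α) arcImage := by
  have hs : 0 < sin α := sin_pos_of_pos_of_lt_pi (by linarith [pi_pos]) h2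
  have hc : cos α < 0 := cos_neg_of_pi_div_two_lt_of_lt h1 (by linarith [pi_pos])
  have hκ : 0 < -(cos α / sin α) := by
    have := div_neg_of_neg_of_pos hc hs
    linarith
  have himg : ∀ a b c, IsArcEdge α (a, b, c) → 0 < orient a c b →
      arcImage (a, b, c) = arcSet (-(cos α / sin α)) a c := by
    intro a b c h ho
    have hac : a ≠ c := h.1
    have hang : ∠ a b c = α := h.2.2
    ext x
    constructor
    · rintro (hx | ⟨hx1, hx2⟩)
      · rcases hx with rfl | rfl
        · exact (arc_crv hκ hac).left_mem
        · exact (arc_crv hκ hac).right_mem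
      · simp only at hx1 hx2
        rw [hang, angle_iff h1 h2] at hx2
        rw [sSameSide_iff_orient hac] at hx1
        have hp : 0 < orient a c x := pos_of_mul_pos_left hx1 ho.le
        rw [abs_of_pos hp] at hx2
        exact ⟨hp.le, hx2.2⟩
    · intro hx
      rcases hx.1.lt_or_eq with hp | hp
      · right
        refine ⟨(sSameSide_iff_orient hac).2 (mul_pos hp ho), ?_⟩
        show ∠ a x c = ∠ a b c
        rw [hang, angle_iff h1 h2, abs_of_pos hp]
        exact ⟨hp.ne', hx.2⟩
      · left
        exact (arc_crv hκ hac).ends x hx hp.symm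
  refine ⟨?_, ?_, ?_, ?_, ?_, ?_, ?_⟩
  · intro a b c h
    exact ((angle_iff h1 h2 a b c).1 h.2.2).1
  · intro a b c h
    refine ⟨h.1.symm, ?_, (EuclideanGeometry.angle_comm _ _ _).trans h.2.2⟩
    have := h.2.1
    simp only at this ⊢
    rwa [Set.pair_comm]
  · intro a b c _
    unfold arcImage
    simp only
    rw [Set.pair_comm c a, EuclideanGeometry.angle_comm c b a]
    simp only [EuclideanGeometry.angle_comm c _ a]
  · intro a b c h
    right
    refine ⟨(sSameSide_iff_orient h.1).2 ?_, rfl⟩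
    exact mul_self_pos.2 ((angle_iff h1 h2 a b c).1 h.2.2).1
  · intro a b c h ho
    rw [himg a b c h ho]
    exact arc_crv hκ h.1
  · intro a b b' c h h' ho ho'
    left
    rw [himg a b c h ho, himg a b' c h' ho']
  · intro a c hac
    obtain ⟨u, v⟩ := apex_spec hκ hac
    refine ⟨hac, ?_, (angle_iff h1 h2 _ _ _).2 ⟨u.ne', ?_⟩⟩
    · exact fun h => u.ne' ((mem_affineSpan_iff_orient hac).1 h)
    · rwa [abs_of_pos u]

/-- For `P` in general position there is a threshold `α₀` such that for all `α ∈ (α₀,π)`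
the maximum sizes of plane `α`-bend/`α`-arc graphs on `P` equal `M P`, and of plane
`α`-bend/`α`-arc multigraphs equal `2 * M P`. -/
theorem stmt_7 (P : Finset Pt) (hcard : 3 ≤ P.card) (hgp : GenPos P) :
    ∃ α₀ ∈ Set.Ioo (0:ℝ) π, ∀ α ∈ Set.Ioo α₀ π,
      ((∀ E : Finset (Pt × Pt × Pt), IsPlaneBendGraph α P E → E.card ≤ M P) ∧
       (∃ E : Finset (Pt × Pt × Pt), IsPlaneBendGraph α P E ∧ E.card = M P)) ∧
      ((∀ E : Finset (Pt × Pt × Pt), IsPlaneArcGraph α P E → E.card ≤ M P) ∧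
       (∃ E : Finset (Pt × Pt × Pt), IsPlaneArcGraph α P E ∧ E.card = M P)) ∧
      ((∀ E : Finset (Pt × Pt × Pt), IsPlaneBendMultigraph α P E → E.card ≤ 2 * M P) ∧
       (∃ E : Finset (Pt × Pt × Pt), IsPlaneBendMultigraph α P E ∧ E.card = 2 * M P)) ∧
      ((∀ E : Finset (Pt × Pt × Pt), IsPlaneArcMultigraph α P E → E.card ≤ 2 * M P) ∧
       (∃ E : Finset (Pt × Pt × Pt), IsPlaneArcMultigraph α P E ∧ E.card = 2 * M P)) := by
  have hP := hgp.gp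
  obtain ⟨κ₀, hκ₀⟩ := Filter.eventually_atTop.1
    ((eventually_good P).and (Filter.eventually_gt_atTop (0 : ℝ)))
  have hκpos : 0 < κ₀ := (hκ₀ κ₀ le_rfl).2
  have hat : 0 < arctan (1 / κ₀) := arctan_pos.2 (by positivity)
  have hat2 := arctan_lt_pi_div_two (1 / κ₀)
  refine ⟨π - arctan (1 / κ₀), ⟨by linarith [pi_pos], by linarith⟩, ?_⟩
  rintro α ⟨hα1, hα2⟩
  have h1 : π / 2 < α := by linarith
  have hge : κ₀ ≤ -(cos α / sin α) := by
    have hs : 0 < sin α := sin_pos_of_pos_of_lt_pi (by linarith [pi_pos]) hα2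
    have hc : cos α < 0 := cos_neg_of_pi_div_two_lt_of_lt h1 (by linarith [pi_pos])
    have ht : tan (π - α) < tan (arctan (1 / κ₀)) :=
      tan_lt_tan_of_lt_of_lt_pi_div_two (by linarith) hat2 (by linarith)
    rw [tan_arctan, tan_eq_sin_div_cos, sin_pi_sub, cos_pi_sub, div_lt_div_iff₀ (by linarith)
      hκpos] at ht
    rw [← neg_div, le_div_iff₀ hs]
    linarith
  have hκ := (hκ₀ _ hge).1
  have hB := bend_fam h1 hα2
  have hA := arc_fam h1 hα2
  exact ⟨⟨fun E hE => upper_graph hP hκ hB hE, lower_graph hP hκ hB⟩,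
    ⟨fun E hE => upper_graph hP hκ hA hE, lower_graph hP hκ hA⟩,
    ⟨fun E hE => upper_multi hP hκ hB hE, lower_multi hP hκ hB⟩,
    ⟨fun E hE => upper_multi hP hκ hA hE, lower_multi hP hκ hA⟩⟩
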